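/- For each n ≥ 1, let U_n be uniformly distributed on {1,…,n}, independent of the uniformly random permutation generating the tree, and let X_{n,U_n} be the depth of the node containing U_n in the random binary search tree built from a uniformly random permutation of {1,…,n}. Then (X_{n,U_n} − 2·log n)/√(2·log n) converges in distribution to the standard normal distribution as n → ∞. -/

import Mathlib

open MeasureTheory ProbabilityTheory Finset Filter
open scoped ENNReal NNReal

noncomputable section

/-- The `k`-th harmonic number `H_k = ∑_{i=1}^k 1/i`, with `H_0 = 0`. -/
def harm (k : ℕ) : ℝ := ∑ i ∈ Finset.range k, (1 : ℝ) / (i + 1)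

instance (n : ℕ) : MeasurableSpace (Equiv.Perm (Fin n)) := ⊤

/-- The uniform distribution on the permutations of `{1,…,n}`. -/
def uniformPerm (n : ℕ) : Measure (Equiv.Perm (Fin n)) :=
  (PMF.uniformOfFintype (Equiv.Perm (Fin n))).toMeasure

/-- The (1-based) position `N = π⁻¹(l)` of the key `l` in the permutation `π`
(positions are `i+1` for `i : Fin n`, values are `π i + 1`). -/
def bstN (n l : ℕ) (π : Equiv.Perm (Fin n)) : ℕ :=
  1 + ∑ i : Fin n, if (π i : ℕ) + 1 = l then (i : ℕ) else 0

open scoped Classical in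
/-- `R₋`: the number of ascending records in the subpermutation of values `< l`
appearing before the position of `l`. -/
def bstRminus (n l : ℕ) (π : Equiv.Perm (Fin n)) : ℕ :=
  (Finset.univ.filter fun r : Fin n =>
    (r : ℕ) + 1 < bstN n l π ∧ (π r : ℕ) + 1 < l ∧
      ∀ k : Fin n, k < r → (π k : ℕ) + 1 < l → π k < π r).card

open scoped Classical in
/-- `R₊`: the number of descending records in the subpermutation of values `> l`
appearing before the position of `l`. -/
def bstRplus (n l : ℕ) (π : Equiv.Perm (Fin n)) : ℕ :=
  (Finset.univ.filter fun r : Fin n =>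
    (r : ℕ) + 1 < bstN n l π ∧ (π r : ℕ) + 1 > l ∧
      ∀ k : Fin n, k < r → (π k : ℕ) + 1 > l → π r < π k).card

/-- `X_{n,l} = R₋ + R₊`: the depth of the node containing `l` in the binary search
tree built from the permutation `π` of `{1,…,n}`. -/
def bstDepth (n l : ℕ) (π : Equiv.Perm (Fin n)) : ℕ :=
  bstRminus n l π + bstRplus n l π

open scoped Classical in
/-- `G = #{1 ≤ i < N : π(i) < l}`. -/
def bstG (n l : ℕ) (π : Equiv.Perm (Fin n)) : ℕ :=
  (Finset.univ.filter fun i : Fin n =>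
    (i : ℕ) + 1 < bstN n l π ∧ (π i : ℕ) + 1 < l).card

/-- The expectation `E X_{n,l}` of the depth of the node containing `l`. -/
def bstExp (n l : ℕ) : ℝ := ∫ π, (bstDepth n l π : ℝ) ∂(uniformPerm n)

/-- The hypergeometric probability mass function: for `X ~ HypGeo(N; M, n)`,
`P(X = k) = C(M,k)·C(N−M,n−k)/C(N,n)` for `0 ≤ k ≤ n` (and `0` otherwise). -/
def hypPMF (N M n k : ℕ) : ℝ :=
  if k ≤ n then (M.choose k * (N - M).choose (n - k) : ℝ) / (N.choose n) else 0

/-- Total variation distance between (probability) measures on `ℕ`. -/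
def dTV (μ ν : Measure ℕ) : ℝ := ⨆ A : Set ℕ, |(μ A).toReal - (ν A).toReal|

/-- The Wasserstein-type distance `d_W` of Barbour–Holst–Janson: the supremum of
`|∫ f dμ − ∫ f dν|` over measurable `f` with `|f(x) − f(y)| ≤ 1` whenever `|x − y| ≤ 1`. -/
def dW (μ ν : Measure ℝ) : ℝ :=
  sSup { d : ℝ | ∃ f : ℝ → ℝ, Measurable f ∧ (∀ x y, |x - y| ≤ 1 → |f x - f y| ≤ 1) ∧
    d = |∫ x, f x ∂μ - ∫ x, f x ∂ν| }

/-- The mixed Poisson distribution with mixing measure `ν`: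
`MixPo(ν)({k}) = ∫ e^{−λ} λ^k / k! ν(dλ)`. -/
def mixPo (ν : Measure ℝ) : Measure ℕ :=
  Measure.sum fun k =>
    (∫⁻ l, ENNReal.ofReal (Real.exp (-l) * l ^ k / k.factorial) ∂ν) • Measure.dirac k

/-- The standard normal cumulative distribution function `Φ`. -/
def stdNormalCDF (x : ℝ) : ℝ :=
  (1 / Real.sqrt (2 * Real.pi)) * ∫ y in Set.Iic x, Real.exp (-y ^ 2 / 2)

end
/-- The uniform distribution on `{1,…,n} ⊆ ℕ`. -/
noncomputable def unifIcc (n : ℕ) : Measure ℕ :=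
  Measure.sum fun m =>
    if m ∈ Finset.Icc 1 n then ((n : ℝ≥0∞))⁻¹ • Measure.dirac m else 0

open scoped Classical in
/-- The depth of the external node of the binary search tree built from `σ` that lies above
exactly `g` keys. -/
noncomputable def gapDepth {n : ℕ} (σ : Equiv.Perm (Fin n)) (g : ℕ) : ℕ :=
  (Finset.univ.filter fun r : Fin n =>
    (σ r : ℕ) < g ∧ ∀ k : Fin n, k < r → (σ k : ℕ) < g → σ k < σ r).card +
  (Finset.univ.filter fun r : Fin n =>
    g ≤ (σ r : ℕ) ∧ ∀ k : Fin n, k < r → g ≤ (σ k : ℕ) → σ r < σ k).card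

/-- The permutation with last value `v` whose other values are ordered like those of `σ`. -/
def insertLast {n : ℕ} (v : Fin (n + 1)) (σ : Equiv.Perm (Fin n)) : Equiv.Perm (Fin (n + 1)) :=
  finSuccEquivLast.trans ((Equiv.optionCongr σ).trans (finSuccEquiv' v).symm)

@[simp]
theorem insertLast_last {n : ℕ} (v : Fin (n + 1)) (σ : Equiv.Perm (Fin n)) :
    insertLast v σ (Fin.last n) = v := by
  simp [insertLast]

@[simp]
theorem insertLast_castSucc {n : ℕ} (v : Fin (n + 1)) (σ : Equiv.Perm (Fin n)) (i : Fin n) :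
    insertLast v σ i.castSucc = v.succAbove (σ i) := by
  simp [insertLast]

theorem insertLast_bijective (n : ℕ) :
    Function.Bijective fun p : Fin (n + 1) × Equiv.Perm (Fin n) => insertLast p.1 p.2 := by
  rw [Fintype.bijective_iff_injective_and_card]
  refine ⟨?_, by simp [Fintype.card_perm, Nat.factorial_succ]⟩
  rintro ⟨v, σ⟩ ⟨w, τ⟩ h
  have hv : v = w := by simpa using DFunLike.congr_fun h (Fin.last n)
  subst hv
  congr 1
  refine Equiv.ext fun i => ?_
  simpa using DFunLike.congr_fun h i.castSucc

theorem sum_perm_succ {M : Type*} [AddCommMonoid M] {n : ℕ} (f : Equiv.Perm (Fin (n + 1)) → M) :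
    ∑ π, f π = ∑ v, ∑ σ, f (insertLast v σ) := by
  rw [← Fintype.sum_prod_type']
  exact ((insertLast_bijective n).sum_comp f).symm

theorem bstN_apply {n : ℕ} (π : Equiv.Perm (Fin n)) (i : Fin n) :
    bstN n ((π i : ℕ) + 1) π = i + 1 := by
  simp [bstN, Fin.val_inj, add_comm]

theorem card_filter_fin_succ {n : ℕ} (p : Fin (n + 1) → Prop) [DecidablePred p] :
    (Finset.univ.filter p).card =
      (Finset.univ.filter fun i : Fin n => p i.castSucc).card + if p (Fin.last n) then 1 else 0 := by
  simp only [Finset.card_filter, Fin.sum_univ_castSucc]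

theorem val_succAbove_lt_self_iff {n : ℕ} (v : Fin (n + 1)) (a : Fin n) :
    (v.succAbove a : ℕ) < v ↔ (a : ℕ) < v := by
  unfold Fin.succAbove
  split_ifs with h
  all_goals simp only [Fin.lt_def, Fin.val_castSucc, Fin.val_succ] at *
  omega

theorem val_self_lt_succAbove_iff {n : ℕ} (v : Fin (n + 1)) (a : Fin n) :
    (v : ℕ) < v.succAbove a ↔ (v : ℕ) ≤ a := by
  unfold Fin.succAbove
  split_ifs with h <;> simp only [Fin.lt_def, Fin.val_castSucc, Fin.val_succ] at * <;> omega

theorem val_succAbove_lt_castSucc_succAbove_iff {n : ℕ} (v g : Fin (n + 1)) (a : Fin n) :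
    (v.succAbove a : ℕ) < v.castSucc.succAbove g ↔ (a : ℕ) < g := by
  unfold Fin.succAbove
  split_ifs with h h' <;>
    simp only [Fin.lt_def, Fin.val_castSucc, Fin.val_succ] at * <;> omega

theorem val_lt_castSucc_succAbove_iff {n : ℕ} (v g : Fin (n + 1)) :
    (v : ℕ) < v.castSucc.succAbove g ↔ v ≤ g := by
  unfold Fin.succAbove
  split_ifs with h <;>
    simp only [Fin.lt_def, Fin.le_def, Fin.val_castSucc, Fin.val_succ] at * <;> omega

theorem bstDepth_insertLast_self {n : ℕ} (v : Fin (n + 1)) (σ : Equiv.Perm (Fin n)) :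
    bstDepth (n + 1) (v + 1) (insertLast v σ) = gapDepth σ v := by
  have hN : bstN (n + 1) (v + 1) (insertLast v σ) = n + 1 := by
    simpa using bstN_apply (insertLast v σ) (Fin.last n)
  simp only [bstDepth, bstRminus, bstRplus, gapDepth, hN, card_filter_fin_succ,
    Fin.forall_fin_succ', insertLast_last, insertLast_castSucc, add_lt_add_iff_right, gt_iff_lt,
    val_succAbove_lt_self_iff, val_self_lt_succAbove_iff, Fin.succAbove_lt_succAbove_iff,
    Fin.castSucc_lt_castSucc_iff, Fin.val_last, Fin.val_castSucc, Fin.is_lt, lt_irrefl,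
    (Fin.castSucc_lt_last _).not_gt, false_and, false_imp_iff, true_and, and_true, if_false,
    add_zero]

theorem bstDepth_insertLast_succAbove {n : ℕ} (v : Fin (n + 1)) (σ : Equiv.Perm (Fin n))
    (u : Fin n) :
    bstDepth (n + 1) (v.succAbove u + 1) (insertLast v σ) = bstDepth n (u + 1) σ := by
  have h' := bstN_apply σ (σ.symm u)
  rw [Equiv.apply_symm_apply] at h'
  have hN : bstN (n + 1) (v.succAbove u + 1) (insertLast v σ) = bstN n (u + 1) σ := by
    have h := bstN_apply (insertLast v σ) (σ.symm u).castSucc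
    rw [insertLast_castSucc, Equiv.apply_symm_apply] at h
    rw [h, h', Fin.val_castSucc]
  have hle : ¬ n + 1 < bstN n (u + 1) σ := by
    rw [h']
    omega
  simp only [bstDepth, bstRminus, bstRplus, hN, card_filter_fin_succ,
    Fin.forall_fin_succ', insertLast_castSucc, add_lt_add_iff_right, gt_iff_lt,
    Fin.val_fin_lt, Fin.succAbove_lt_succAbove_iff, hle,
    Fin.castSucc_lt_castSucc_iff, Fin.val_last, Fin.val_castSucc,
    (Fin.castSucc_lt_last _).not_gt, false_and, false_imp_iff, and_true, if_false,
    add_zero]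

theorem gapDepth_insertLast_self {n : ℕ} (v : Fin (n + 1)) (σ : Equiv.Perm (Fin n)) :
    gapDepth (insertLast v σ) v = gapDepth σ v + 1 := by
  have h (k : Fin n) : (v : ℕ) ≤ v.succAbove (σ k) → v < v.succAbove (σ k) := fun h =>
    lt_of_le_of_ne h (v.succAbove_ne _).symm
  simp only [gapDepth, card_filter_fin_succ,
    Fin.forall_fin_succ', insertLast_last, insertLast_castSucc, ← not_lt (α := ℕ),
    val_succAbove_lt_self_iff, Fin.succAbove_lt_succAbove_iff,
    Fin.castSucc_lt_castSucc_iff, lt_irrefl,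
    (Fin.castSucc_lt_last _).not_gt, false_and, false_imp_iff, and_true, if_false, add_zero]
  rw [if_pos ⟨not_false, fun k _ hk => Fin.lt_def.2 ((val_self_lt_succAbove_iff v _).2 (not_lt.1 hk))⟩,
    add_assoc]

theorem gapDepth_insertLast_succAbove {n : ℕ} (v g : Fin (n + 1)) (σ : Equiv.Perm (Fin n)) :
    gapDepth (insertLast v σ) (v.castSucc.succAbove g) =
      gapDepth σ g + if g = v then 1 else 0 := by
  have below : ((v ≤ g) ∧ ∀ k : Fin n, (k.castSucc < Fin.last n) → (σ k : ℕ) < g →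
      v.succAbove (σ k) < v) ↔ g = v := by
    refine ⟨fun ⟨hvg, h⟩ => ?_, fun h => ⟨h.ge, fun k _ hk => ?_⟩⟩
    · by_contra hne
      have hlt : (v : ℕ) < g := lt_of_le_of_ne hvg fun h => hne (Fin.ext h.symm)
      have := h (σ.symm ⟨v, by omega⟩) (Fin.castSucc_lt_last _) (by simpa using hlt)
      rw [Fin.lt_def, val_succAbove_lt_self_iff, Equiv.apply_symm_apply] at this
      exact lt_irrefl _ this
    · rwa [Fin.lt_def, val_succAbove_lt_self_iff, ← h]
  have above : ¬ ((¬ v ≤ g) ∧ ∀ k : Fin n, (k.castSucc < Fin.last n) → ¬ (σ k : ℕ) < g →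
      v < v.succAbove (σ k)) := by
    rintro ⟨hvg, h⟩
    have hlt : (g : ℕ) < v := not_le.1 hvg
    have := h (σ.symm ⟨g, by omega⟩) (Fin.castSucc_lt_last _) (by simp)
    rw [Fin.lt_def, val_self_lt_succAbove_iff, Equiv.apply_symm_apply] at this
    exact absurd hlt (not_lt.2 this)
  simp only [gapDepth, card_filter_fin_succ,
    Fin.forall_fin_succ', insertLast_last, insertLast_castSucc, ← not_lt (α := ℕ),
    val_succAbove_lt_castSucc_succAbove_iff, val_lt_castSucc_succAbove_iff,
    Fin.succAbove_lt_succAbove_iff, Fin.castSucc_lt_castSucc_iff, lt_irrefl,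
    (Fin.castSucc_lt_last _).not_gt, false_imp_iff, and_true, below, above, if_false]
  ring

section GeneratingFunction

variable {R : Type*} [CommRing R]

/-- The generating function of the depths of all external nodes over all permutations. -/
noncomputable def gapSum (x : R) (n : ℕ) : R :=
  ∑ σ : Equiv.Perm (Fin n), ∑ g : Fin (n + 1), x ^ gapDepth σ g

/-- The generating function of the depths of all keys over all permutations. -/
noncomputable def depthSum (x : R) (n : ℕ) : R :=
  ∑ σ : Equiv.Perm (Fin n), ∑ l : Fin n, x ^ bstDepth n (l + 1) σ

theorem gapSum_zero (x : R) : gapSum x 0 = 1 := by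
  simp [gapSum, gapDepth]

theorem gapSum_succ (x : R) (n : ℕ) : gapSum x (n + 1) = (n + 2 * x) * gapSum x n := by
  have key (v : Fin (n + 1)) (σ : Equiv.Perm (Fin n)) :
      ∑ g : Fin (n + 2), x ^ gapDepth (insertLast v σ) g =
        ∑ g : Fin (n + 1), x ^ gapDepth σ g + (2 * x - 1) * x ^ gapDepth σ v := by
    have hpt (g : Fin (n + 1)) : x ^ (gapDepth σ g + if g = v then 1 else 0) =
        x ^ gapDepth σ g + if g = v then (x - 1) * x ^ gapDepth σ v else 0 := by
      split_ifs with h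
      · rw [h]; ring
      · simp
    rw [Fin.sum_univ_succAbove _ v.castSucc]
    simp only [gapDepth_insertLast_succAbove, hpt, Fin.val_castSucc, gapDepth_insertLast_self,
      Finset.sum_add_distrib, Finset.sum_ite_eq', Finset.mem_univ, if_true]
    ring
  rw [gapSum, sum_perm_succ]
  simp only [key, Finset.sum_add_distrib, ← Finset.mul_sum]
  have hswap : ∑ v : Fin (n + 1), ∑ σ : Equiv.Perm (Fin n), x ^ gapDepth σ v = gapSum x n :=
    Finset.sum_comm
  rw [hswap, Finset.sum_const, Finset.card_univ, Fintype.card_fin, nsmul_eq_mul, ← gapSum]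
  push_cast
  ring

theorem depthSum_zero (x : R) : depthSum x 0 = 0 := by
  simp [depthSum]

theorem depthSum_succ (x : R) (n : ℕ) :
    depthSum x (n + 1) = gapSum x n + (n + 1) * depthSum x n := by
  rw [depthSum, sum_perm_succ]
  have key (v : Fin (n + 1)) (σ : Equiv.Perm (Fin n)) :
      ∑ l : Fin (n + 1), x ^ bstDepth (n + 1) (l + 1) (insertLast v σ) =
        x ^ gapDepth σ v + ∑ l : Fin n, x ^ bstDepth n (l + 1) σ := by
    rw [Fin.sum_univ_succAbove _ v]
    simp only [bstDepth_insertLast_self, bstDepth_insertLast_succAbove]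
  simp only [key, Finset.sum_add_distrib]
  rw [Finset.sum_comm, ← gapSum, Finset.sum_const]
  simp [depthSum]

theorem mul_depthSum (x : R) (n : ℕ) :
    (2 * x - 1) * depthSum x n = gapSum x n - n.factorial := by
  induction n with
  | zero => simp [depthSum_zero, gapSum_zero]
  | succ n ih =>
    rw [depthSum_succ, gapSum_succ, Nat.factorial_succ]
    push_cast
    linear_combination (n + 1 : R) * ih

theorem gapSum_eq_prod (x : R) (n : ℕ) : gapSum x n = ∏ i ∈ Finset.range n, (i + 2 * x) := by
  induction n with
  | zero => simp [gapSum_zero]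
  | succ n ih => rw [gapSum_succ, ih, Finset.prod_range_succ, mul_comm]

end GeneratingFunction

section Asymptotics

open Complex Topology

theorem norm_one_add_mul_exp_neg_sub_one_le {a : ℂ} (ha : ‖a‖ ≤ 1) :
    ‖(1 + a) * cexp (-a) - 1‖ ≤ 3 * ‖a‖ ^ 2 := by
  have h1 : ‖cexp (-a) - 1 - -a‖ ≤ ‖a‖ ^ 2 := by
    simpa using norm_exp_sub_one_sub_id_le (x := -a) (by simpa using ha)
  have h2 : ‖1 + a‖ ≤ 2 := (norm_add_le _ _).trans (by rw [norm_one]; linarith)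
  calc ‖(1 + a) * cexp (-a) - 1‖ = ‖(1 + a) * (cexp (-a) - 1 - -a) - a ^ 2‖ := by ring_nf
    _ ≤ ‖1 + a‖ * ‖cexp (-a) - 1 - -a‖ + ‖a‖ ^ 2 := by
      grw [norm_sub_le, norm_mul, norm_pow]
    _ ≤ 2 * ‖a‖ ^ 2 + ‖a‖ ^ 2 := by gcongr
    _ = 3 * ‖a‖ ^ 2 := by ring

theorem tendsto_prod_one_add_div_mul_exp {w : ℕ → ℂ} (hw : Tendsto w atTop (𝓝 0)) :
    Tendsto (fun n => (∏ i ∈ Finset.range n, (1 + w n / (i + 2))) *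
      cexp (-(w n * ∑ i ∈ Finset.range n, 1 / ((i : ℂ) + 2)))) atTop (𝓝 1) := by
  have hsum : Summable fun i : ℕ => 1 / ((i : ℝ) + 2) ^ 2 := by
    exact_mod_cast (summable_nat_add_iff 2).2 (Real.summable_one_div_nat_pow.2 one_lt_two)
  set C := ∑' i : ℕ, 1 / ((i : ℝ) + 2) ^ 2
  have hlim : Tendsto (fun n => Real.exp (3 * ‖w n‖ ^ 2 * C) - 1) atTop (𝓝 0) := by
    have : Tendsto (fun n => Real.exp (3 * ‖w n‖ ^ 2 * C) - 1) atTop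
        (𝓝 (Real.exp (3 * ‖(0 : ℂ)‖ ^ 2 * C) - 1)) :=
      ((Real.continuous_exp.tendsto _).comp
        (((hw.norm.pow 2).const_mul 3).mul_const C)).sub_const 1
    simpa using this
  rw [← tendsto_sub_nhds_zero_iff]
  refine squeeze_zero_norm' ?_ hlim
  filter_upwards [hw.norm.eventually (Iic_mem_nhds (norm_zero.trans_lt one_pos))] with n hn
  have hi (i : ℕ) : ‖w n / (i + 2)‖ = ‖w n‖ / (i + 2) := by
    rw [norm_div]
    norm_cast
  have hprod : (∏ i ∈ Finset.range n, (1 + w n / (i + 2))) *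
      cexp (-(w n * ∑ i ∈ Finset.range n, 1 / ((i : ℂ) + 2))) =
      ∏ i ∈ Finset.range n, (1 + ((1 + w n / (i + 2)) * cexp (-(w n / (i + 2))) - 1)) := by
    simp only [add_sub_cancel, Finset.prod_mul_distrib, ← Complex.exp_sum, Finset.sum_neg_distrib,
      Finset.mul_sum, mul_one_div]
  rw [hprod]
  refine (Finset.norm_prod_one_add_sub_one_le _ _).trans ?_
  gcongr
  calc ∑ i ∈ Finset.range n, ‖(1 + w n / (i + 2)) * cexp (-(w n / (i + 2))) - 1‖
      ≤ ∑ i ∈ Finset.range n, 3 * ‖w n‖ ^ 2 * (1 / ((i : ℝ) + 2) ^ 2) := by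
        refine Finset.sum_le_sum fun i _ => ?_
        refine (norm_one_add_mul_exp_neg_sub_one_le ?_).trans (le_of_eq ?_)
        · rw [hi]
          refine div_le_one_of_le₀ (hn.trans ?_) (by positivity)
          have : (0 : ℝ) ≤ i := i.cast_nonneg
          linarith
        · rw [hi, div_pow, mul_assoc, mul_one_div]
    _ = 3 * ‖w n‖ ^ 2 * ∑ i ∈ Finset.range n, 1 / ((i : ℝ) + 2) ^ 2 := by rw [Finset.mul_sum]
    _ ≤ 3 * ‖w n‖ ^ 2 * C := by
      gcongr
      exact hsum.sum_le_tsum _ fun i _ => by positivity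

theorem tendsto_sum_one_div_add_two_sub_log :
    Tendsto (fun n : ℕ => ∑ i ∈ Finset.range n, 1 / ((i : ℝ) + 2) - Real.log n) atTop
      (𝓝 (Real.eulerMascheroniConstant - 1)) := by
  have h (n : ℕ) : ∑ i ∈ Finset.range n, 1 / ((i : ℝ) + 2) =
      harmonic n + (1 / ((n : ℝ) + 1) - 1) := by
    induction n with
    | zero => simp
    | succ n ih =>
      rw [Finset.sum_range_succ, ih, harmonic_succ]
      push_cast
      ring
  have := Real.tendsto_harmonic_sub_log.add
    ((tendsto_one_div_add_atTop_nhds_zero_nat (𝕜 := ℝ)).sub_const 1)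
  rw [zero_sub, ← sub_eq_add_neg] at this
  refine this.congr fun n => ?_
  rw [h]
  ring

theorem tendsto_sq_mul_exp_div_sub_one_sub (θ : ℝ) :
    Tendsto (fun s : ℝ => (s : ℂ) ^ 2 * (cexp (θ / s * I) - 1) - θ * s * I) atTop
      (𝓝 (-(θ : ℂ) ^ 2 / 2)) := by
  have hdiv : Tendsto (fun s : ℝ => |θ| / s) atTop (𝓝 0) := tendsto_const_nhds.div_atTop tendsto_id
  have hlim : Tendsto (fun s : ℝ => θ ^ 2 * (|θ| / s) * Real.exp (|θ| / s)) atTop (𝓝 0) := by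
    simpa using (hdiv.const_mul (θ ^ 2)).mul ((Real.continuous_exp.tendsto 0).comp hdiv)
  rw [← tendsto_sub_nhds_zero_iff]
  refine squeeze_zero_norm' ?_ hlim
  filter_upwards [eventually_gt_atTop 0] with s hs
  have hs' : (s : ℂ) ≠ 0 := by exact_mod_cast hs.ne'
  have hx : ‖(θ / s * I : ℂ)‖ = |θ| / s := by
    rw [norm_mul, norm_I, mul_one, norm_div, norm_real, norm_real, Real.norm_eq_abs,
      Real.norm_eq_abs, abs_of_pos hs]
  have hexp := norm_exp_sub_sum_le_norm_mul_exp (θ / s * I) 3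
  rw [hx] at hexp
  have hrw : (s : ℂ) ^ 2 * (cexp (θ / s * I) - 1) - θ * s * I - -(θ : ℂ) ^ 2 / 2 =
      (s : ℂ) ^ 2 * (cexp (θ / s * I) - ∑ m ∈ Finset.range 3, (θ / s * I) ^ m / m.factorial) := by
    simp only [Finset.sum_range_succ, Finset.sum_range_zero, Nat.factorial]
    field_simp
    rw [I_sq]
    push_cast
    ring
  rw [hrw, norm_mul, norm_pow, norm_real, Real.norm_eq_abs, abs_of_pos hs]
  refine (mul_le_mul_of_nonneg_left hexp (by positivity)).trans (le_of_eq ?_)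
  rw [← sq_abs θ]
  field_simp

/-- The characteristic functions of the normalized depth of a uniformly random key converge to
that of the standard normal distribution. -/
theorem tendsto_exp_mul_depthSum (θ : ℝ) :
    Tendsto (fun n : ℕ => cexp (-(θ * (√(2 * Real.log n) : ℝ) * I)) *
      (depthSum (cexp (θ / (√(2 * Real.log n) : ℝ) * I)) n / (n.factorial * n))) atTop
      (𝓝 (cexp (-(θ : ℂ) ^ 2 / 2))) := by
  have hlog : Tendsto (fun n : ℕ => Real.log n) atTop atTop :=
    Real.tendsto_log_atTop.comp tendsto_natCast_atTop_atTop
  set s : ℕ → ℝ := fun n => √(2 * Real.log n) with hs_def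
  have hs : Tendsto s atTop atTop :=
    Real.tendsto_sqrt_atTop.comp (hlog.const_mul_atTop two_pos)
  set x : ℕ → ℂ := fun n => cexp (θ / s n * I) with hx_def
  have hx : Tendsto x atTop (𝓝 1) := by
    have h : Tendsto (fun n => ((θ / s n : ℝ) : ℂ) * I) atTop (𝓝 ((0 : ℝ) * I)) :=
      ((continuous_ofReal.tendsto 0).comp (tendsto_const_nhds.div_atTop hs)).mul_const I
    simpa [hx_def, Function.comp_def] using (Complex.continuous_exp.tendsto _).comp h
  set w : ℕ → ℂ := fun n => 2 * (x n - 1) with hw_def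
  have hw : Tendsto w atTop (𝓝 0) := by
    simpa using (hx.sub_const 1).const_mul 2
  have hmain : Tendsto (fun n : ℕ => cexp (-(θ * s n * I)) *
      ∏ i ∈ Finset.range n, (1 + w n / (i + 2))) atTop (𝓝 (cexp (-(θ : ℂ) ^ 2 / 2))) := by
    have h1 : Tendsto (fun n : ℕ => w n *
        ((∑ i ∈ Finset.range n, 1 / ((i : ℝ) + 2) - Real.log n : ℝ) : ℂ)) atTop (𝓝 0) := by
      simpa using hw.mul ((continuous_ofReal.tendsto _).comp tendsto_sum_one_div_add_two_sub_log)
    have h2 := (tendsto_sq_mul_exp_div_sub_one_sub θ).comp hs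
    have h3 := (tendsto_prod_one_add_div_mul_exp hw).mul
      ((Complex.continuous_exp.tendsto _).comp (h1.add h2))
    rw [one_mul, zero_add] at h3
    refine h3.congr' ?_
    filter_upwards [hlog.eventually_ge_atTop 0] with n hn
    have hsq : (s n : ℂ) ^ 2 = 2 * (Real.log n : ℂ) := by
      rw [← ofReal_pow, hs_def, Real.sq_sqrt (by positivity)]
      push_cast
      rfl
    simp only [Function.comp_apply]
    rw [mul_assoc, ← Complex.exp_add, mul_comm (∏ i ∈ _, _), hsq]
    congr 2
    push_cast
    simp only [hw_def, hx_def]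
    ring
  have hn1 : Tendsto (fun n : ℕ => 1 / (n : ℂ)) atTop (𝓝 0) := tendsto_one_div_atTop_nhds_zero_nat
  have hbdd : Tendsto (fun n : ℕ => cexp (-(θ * s n * I)) * (1 / (n : ℂ))) atTop (𝓝 0) := by
    refine squeeze_zero_norm (fun n => ?_) (by simpa using hn1.norm)
    rw [norm_mul, ← neg_mul, ← ofReal_mul, ← ofReal_neg, norm_exp_ofReal_mul_I, one_mul]
    simp
  have hden : Tendsto (fun n => 2 * x n - 1) atTop (𝓝 1) := by
    convert (hx.const_mul 2).sub_const 1 using 2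
    norm_num
  have hfin := (((hmain.mul (hn1.const_add 1)).sub hbdd).div hden one_ne_zero)
  simp only [add_zero, mul_one, sub_zero, div_one] at hfin
  refine hfin.congr' ?_
  filter_upwards [hden.eventually_ne one_ne_zero, eventually_gt_atTop 0] with n hne hn
  have hn' : (n : ℂ) ≠ 0 := by exact_mod_cast hn.ne'
  have hfac : (n.factorial : ℂ) ≠ 0 := by exact_mod_cast n.factorial_ne_zero
  have hgap : gapSum (x n) n =
      n.factorial * (n + 1) * ∏ i ∈ Finset.range n, (1 + w n / (i + 2)) := by
    have (m : ℕ) : ∏ i ∈ Finset.range m, ((i : ℂ) + 2 * x n) =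
        m.factorial * (m + 1) * ∏ i ∈ Finset.range m, (1 + w n / (i + 2)) := by
      induction m with
      | zero => simp
      | succ m ih =>
        have : (m : ℂ) + 2 ≠ 0 := by exact_mod_cast (m + 1).succ_ne_zero
        rw [Finset.prod_range_succ, ih, Finset.prod_range_succ, Nat.factorial_succ, hw_def]
        push_cast
        field_simp
        ring
    rw [gapSum_eq_prod, this]
  have hdepth : depthSum (x n) n = (gapSum (x n) n - n.factorial) / (2 * x n - 1) := by
    rw [← mul_depthSum, mul_div_cancel_left₀ _ hne]
  change _ = cexp (-(θ * s n * I)) * (depthSum (x n) n / _)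
  rw [hdepth, hgap]
  simp only [Pi.div_apply]
  field_simp

end Asymptotics

section Law

instance (n : ℕ) : DiscreteMeasurableSpace (Equiv.Perm (Fin n)) := ⟨fun _ => trivial⟩

instance (n : ℕ) : IsProbabilityMeasure (uniformPerm n) :=
  PMF.toMeasure.isProbabilityMeasure _

theorem unifIcc_eq_sum (n : ℕ) :
    unifIcc n = ∑ l : Fin n, ((n : ℝ≥0∞))⁻¹ • Measure.dirac ((l : ℕ) + 1) := by
  ext s hs
  rw [unifIcc, Measure.sum_apply _ hs, tsum_eq_sum (s := Finset.Icc 1 n)]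
  · rw [Measure.finsetSum_apply,
      Fin.sum_univ_eq_sum_range (fun l => (((n : ℝ≥0∞))⁻¹ • Measure.dirac (l + 1)) s),
      Finset.range_eq_Ico, Finset.sum_Ico_add' (fun l => (((n : ℝ≥0∞))⁻¹ • Measure.dirac l) s)]
    exact Finset.sum_congr (by ext; simp) fun m hm => by
      rw [if_pos (by simpa [Nat.lt_succ_iff] using hm)]
  · intro m hm
    simp [hm]

instance (n : ℕ) [NeZero n] : IsProbabilityMeasure (unifIcc n) := by
  refine ⟨?_⟩
  rw [unifIcc_eq_sum]
  simp [ENNReal.mul_inv_cancel (Nat.cast_ne_zero.2 (NeZero.ne n))]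

theorem integral_uniformPerm_prod_unifIcc (n : ℕ) [NeZero n] {f : Equiv.Perm (Fin n) × ℕ → ℂ}
    (hf : ∀ p, ‖f p‖ ≤ 1) :
    ∫ p, f p ∂(uniformPerm n).prod (unifIcc n) =
      (∑ σ : Equiv.Perm (Fin n), ∑ l : Fin n, f (σ, l + 1)) / (n.factorial * n) := by
  rw [integral_prod _ (Integrable.of_bound .of_discrete 1 (.of_forall hf)),
    uniformPerm, PMF.integral_eq_sum]
  have (σ : Equiv.Perm (Fin n)) : ∫ l, f (σ, l) ∂unifIcc n = (∑ l : Fin n, f (σ, l + 1)) / n := by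
    rw [unifIcc_eq_sum, integral_finsetSum_measure]
    · simp [integral_smul_measure, Finset.mul_sum, div_eq_inv_mul]
    · intro l _
      refine Integrable.smul_measure ?_ (by simp [NeZero.ne n])
      exact Integrable.of_bound .of_discrete 1 (.of_forall fun l => hf _)
  simp only [this, PMF.uniformOfFintype_apply, Fintype.card_perm, Fintype.card_fin]
  rw [Finset.sum_div]
  refine Finset.sum_congr rfl fun σ _ => ?_
  simp
  ring

theorem charFun_normalized_depth (n : ℕ) [NeZero n] (a b t : ℝ) :
    charFun (((uniformPerm n).prod (unifIcc n)).map
      fun p => ((bstDepth n p.2 p.1 : ℝ) - a) / b) t =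
      Complex.exp (-(t * (a / b : ℝ) * Complex.I)) *
        (depthSum (Complex.exp (t / b * Complex.I)) n / (n.factorial * n)) := by
  rw [charFun_apply_real, integral_map .of_discrete (by fun_prop),
    integral_uniformPerm_prod_unifIcc, depthSum, mul_div_assoc', Finset.mul_sum]
  · congr 1
    refine Finset.sum_congr rfl fun σ _ => ?_
    rw [Finset.mul_sum]
    refine Finset.sum_congr rfl fun l _ => ?_
    rw [← Complex.exp_nat_mul, ← Complex.exp_add]
    congr 1
    push_cast
    ring
  · intro p
    rw [← Complex.ofReal_mul, Complex.norm_exp_ofReal_mul_I]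

theorem gaussianReal_Iic_toReal (x : ℝ) :
    (gaussianReal 0 1 (Set.Iic x)).toReal = stdNormalCDF x := by
  rw [gaussianReal_apply_eq_integral _ one_ne_zero, ENNReal.toReal_ofReal, stdNormalCDF,
    ← integral_const_mul]
  · simp [gaussianPDFReal]
  · exact integral_nonneg fun y => gaussianPDFReal_nonneg _ _ _

end Law

theorem depth_random_node_asymptotic_normality :
    ∀ x : ℝ,
      Filter.Tendsto (fun n : ℕ =>
          (((uniformPerm n).prod (unifIcc n))
            {p : Equiv.Perm (Fin n) × ℕ |
              ((bstDepth n p.2 p.1 : ℝ) - 2 * Real.log n)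
                / Real.sqrt (2 * Real.log n) ≤ x}).toReal)
        Filter.atTop (nhds (stdNormalCDF x)) := by
  intro x
  have : NullSingletonClass (gaussianReal 0 1) := nullSingletonClass_gaussianReal one_ne_zero
  let ν : ℕ → ProbabilityMeasure ℝ := fun n =>
    ⟨((uniformPerm (n + 1)).prod (unifIcc (n + 1))).map fun p =>
      ((bstDepth (n + 1) p.2 p.1 : ℝ) - 2 * Real.log (n + 1 : ℕ)) /
        Real.sqrt (2 * Real.log (n + 1 : ℕ)), Measure.isProbabilityMeasure_map .of_discrete⟩
  have hν : Tendsto ν atTop (nhds ⟨gaussianReal 0 1, inferInstance⟩) := by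
    refine ProbabilityMeasure.tendsto_iff_tendsto_charFun.2 fun t => ?_
    have h := (tendsto_exp_mul_depthSum t).comp (tendsto_add_atTop_nat 1)
    simp only [ProbabilityMeasure.coe_mk, charFun_gaussianReal, ν, charFun_normalized_depth,
      Real.div_sqrt]
    convert h using 2
    congr 1
    rw [Complex.ofReal_zero, mul_zero, zero_mul, zero_sub, neg_div, NNReal.coe_one,
      Complex.ofReal_one, one_mul]
  rw [← tendsto_add_atTop_iff_nat 1, ← gaussianReal_Iic_toReal]
  have hlim := ProbabilityMeasure.tendsto_measure_of_null_frontier_of_tendsto' hν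
    (E := Set.Iic x) (by
      rw [frontier_Iic, ProbabilityMeasure.coe_mk]
      exact measure_singleton x)
  have := (ENNReal.tendsto_toReal (measure_ne_top (gaussianReal 0 1) _)).comp hlim
  refine this.congr fun n => ?_
  simp only [ν, ProbabilityMeasure.coe_mk, Function.comp_apply]
  rw [Measure.map_apply .of_discrete measurableSet_Iic]
  rfl
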